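/- Let f : B → ℍ be harmonic on the open unit ball B of ℍ with f(0) = 0 and |f(z)| ≤ 1 for all z ∈ B, and suppose that |f(z)| = U(|z|·1) for some nonzero z ∈ B, where U(x) = ∫_{S³} s(ξ) P(x, ξ) ψ(dξ) with s(ξ) = sign of the real part ξ₀ of ξ. Then there exist a quaternion c with |c| = 1 and an ℝ-linear isometry T of ℍ ≅ ℝ⁴ (an orthogonal transformation of ℝ⁴) such that f(x) = c·U(T x) for all x ∈ B. -/

import Mathlib

open MeasureTheory Metric
open scoped Quaternion

noncomputable instance : MeasurableSpace ℍ[ℝ] := borel _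
instance : BorelSpace ℍ[ℝ] := ⟨rfl⟩

/-- The standard basis `1, i₁, i₂, i₃` of the quaternions over ℝ. -/
noncomputable def qe : Fin 4 → ℍ[ℝ]
  | 0 => ⟨1, 0, 0, 0⟩
  | 1 => ⟨0, 1, 0, 0⟩
  | 2 => ⟨0, 0, 1, 0⟩
  | 3 => ⟨0, 0, 0, 1⟩

/-- The Dirac operator `σf(z) = ∑ⱼ (∂f/∂zⱼ)(z)·iⱼ` (with `i₀ = 1`), where `∂/∂zⱼ` is
the partial derivative in the `j`-th real coordinate direction of `ℍ ≅ ℝ⁴`. -/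
noncomputable def Dirac (f : ℍ[ℝ] → ℍ[ℝ]) (z : ℍ[ℝ]) : ℍ[ℝ] :=
  ∑ j : Fin 4, fderiv ℝ f z (qe j) * qe j

/-- The adjoint Dirac operator `σ*f(z) = ∑ⱼ (∂f/∂zⱼ)(z)·iⱼ*`. -/
noncomputable def DiracStar (f : ℍ[ℝ] → ℍ[ℝ]) (z : ℍ[ℝ]) : ℍ[ℝ] :=
  ∑ j : Fin 4, fderiv ℝ f z (qe j) * star (qe j)

/-- The Laplace operator `Δf(z) = ∑ⱼ ∂²f/∂zⱼ²(z)` in the four real coordinates of `ℍ ≅ ℝ⁴`. -/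
noncomputable def qLap (f : ℍ[ℝ] → ℍ[ℝ]) (z : ℍ[ℝ]) : ℍ[ℝ] :=
  ∑ j : Fin 4, fderiv ℝ (fun w => fderiv ℝ f w (qe j)) z (qe j)

/-- The Poisson kernel `P(z, ξ) = (1 − |z|²)/|z − ξ|⁴` of the unit ball of `ℍ ≅ ℝ⁴`. -/
noncomputable def pker (z ξ : ℍ[ℝ]) : ℝ := (1 - ‖z‖ ^ 2) / ‖z - ξ‖ ^ 4

/-- The sign of the real part: `1` if `ξ₀ > 0`, `−1` if `ξ₀ < 0`, `0` if `ξ₀ = 0`. -/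
noncomputable def bdrySign (ξ : ℍ[ℝ]) : ℝ := Real.sign ξ.re

/-- The Poisson integral `U(x) = ∫_{S³} s(ξ) P(x, ξ) ψ(dξ)` of the sign function. -/
noncomputable def Upois (ψ : Measure ℍ[ℝ]) (x : ℍ[ℝ]) : ℝ :=
  ∫ ξ, bdrySign ξ * pker x ξ ∂ψ

open Filter Topology

/-- The symmetric second difference quotient of a function that is twice differentiable at `0`
tends to its second derivative. -/
theorem tendsto_second_difference {φ φ' : ℝ → ℝ} {L : ℝ}
    (h1 : ∀ᶠ t in 𝓝 0, HasDerivAt φ (φ' t) t) (h2 : HasDerivAt φ' L 0) :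
    Tendsto (fun t => (φ t + φ (-t) - 2 * φ 0) / t ^ 2) (𝓝[≠] 0) (𝓝 L) := by
  have hneg : Tendsto (fun t : ℝ => -t) (𝓝 0) (𝓝 0) := by
    simpa using (continuous_neg.tendsto (0 : ℝ))
  have h1n : ∀ᶠ t in 𝓝 (0 : ℝ), HasDerivAt φ (φ' (-t)) (-t) := hneg.eventually h1
  have hc : ContinuousAt φ 0 := h1.self_of_nhds.continuousAt
  refine HasDerivAt.lhopital_zero_nhdsNE (f' := fun t => φ' t - φ' (-t))
    (g' := fun t => 2 * t) ?_ ?_ ?_ ?_ ?_ ?_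
  · filter_upwards [nhdsWithin_le_nhds h1, nhdsWithin_le_nhds h1n] with t ht htn
    have := (ht.add (htn.comp t (hasDerivAt_neg t))).sub_const (2 * φ 0)
    refine this.congr_deriv ?_
    ring
  · refine Eventually.of_forall fun t => ?_
    simpa using hasDerivAt_pow 2 t
  · filter_upwards [self_mem_nhdsWithin] with t ht
    simpa using ht
  · have : Tendsto (fun t => φ t + φ (-t) - 2 * φ 0) (𝓝 0) (𝓝 (φ 0 + φ 0 - 2 * φ 0)) :=
      (hc.tendsto.add (hc.tendsto.comp hneg)).sub_const _
    rw [show φ 0 + φ 0 - 2 * φ 0 = 0 by ring] at this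
    exact this.mono_left nhdsWithin_le_nhds
  · have : Tendsto (fun t : ℝ => t ^ 2) (𝓝 0) (𝓝 (0 ^ 2)) := (continuous_pow 2).tendsto 0
    simpa using this.mono_left nhdsWithin_le_nhds
  · have h3 : HasDerivAt (fun t => φ' t - φ' (-t)) (L - L * -1) 0 := by
      refine h2.sub (HasDerivAt.comp (0 : ℝ) ?_ (hasDerivAt_neg 0))
      simpa using h2
    have h4 := (hasDerivAt_iff_tendsto_slope_zero.1 h3).const_mul (1 / 2)
    refine (h4.congr fun t => ?_).trans_eq ?_
    · simp
      ring
    · congr 1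
      ring

/-- Pointwise harmonicity in terms of symmetric second differences along the coordinate axes;
no differentiability is required. -/
def WeakHarmonicAt (u : ℍ[ℝ] → ℝ) (x : ℍ[ℝ]) : Prop :=
  Tendsto (fun t : ℝ => ∑ j, (u (x + t • qe j) + u (x - t • qe j) - 2 * u x) / t ^ 2)
    (𝓝[≠] 0) (𝓝 0)

theorem WeakHarmonicAt.neg {u : ℍ[ℝ] → ℝ} {x : ℍ[ℝ]} (h : WeakHarmonicAt u x) :
    WeakHarmonicAt (fun y => -u y) x := by
  have := Tendsto.neg h
  rw [neg_zero] at this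
  refine this.congr fun t => ?_
  rw [← Finset.sum_neg_distrib]
  exact Finset.sum_congr rfl fun j _ => by ring

theorem WeakHarmonicAt.sub {u v : ℍ[ℝ] → ℝ} {x : ℍ[ℝ]} (hu : WeakHarmonicAt u x)
    (hv : WeakHarmonicAt v x) : WeakHarmonicAt (fun y => u y - v y) x := by
  have := Tendsto.sub hu hv
  rw [sub_zero] at this
  refine this.congr fun t => ?_
  rw [← Finset.sum_sub_distrib]
  exact Finset.sum_congr rfl fun j _ => by ring

theorem norm_sq_eq_sum (x : ℍ[ℝ]) : ‖x‖ ^ 2 = x.re ^ 2 + x.imI ^ 2 + x.imJ ^ 2 + x.imK ^ 2 := by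
  rw [sq, ← Quaternion.normSq_eq_norm_mul_self, Quaternion.normSq_def']

theorem norm_qe (j : Fin 4) : ‖qe j‖ = 1 := by
  have : ‖qe j‖ ^ 2 = 1 := by
    rw [norm_sq_eq_sum]
    fin_cases j <;> simp [qe]
  nlinarith [norm_nonneg (qe j)]

/-- Maximum principle for weakly harmonic functions on a ball. -/
theorem WeakHarmonicAt.le_of_sphere_le {w : ℍ[ℝ] → ℝ} {ρ m : ℝ}
    (hc : ContinuousOn w (closedBall 0 ρ)) (hw : ∀ x ∈ ball (0 : ℍ[ℝ]) ρ, WeakHarmonicAt w x)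
    (hm : ∀ x ∈ sphere (0 : ℍ[ℝ]) ρ, w x ≤ m) {x : ℍ[ℝ]} (hx : x ∈ closedBall (0 : ℍ[ℝ]) ρ) :
    w x ≤ m := by
  by_contra! hlt
  have hρ : 0 ≤ ρ := nonempty_closedBall.1 ⟨x, hx⟩
  set δ : ℝ := (w x - m) / (2 * (1 + ρ ^ 2)) with hδ
  have hδ0 : 0 < δ := by have := sub_pos.2 hlt; positivity
  have hδm : δ * (2 * (1 + ρ ^ 2)) = w x - m := by
    rw [hδ]; field_simp
  obtain ⟨y, hy, hmax⟩ := (isCompact_closedBall (0 : ℍ[ℝ]) ρ).exists_isMaxOn ⟨x, hx⟩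
    (f := fun y => w y + δ * ‖y‖ ^ 2) (hc.add (by fun_prop))
  have hmax' : ∀ v ∈ closedBall (0 : ℍ[ℝ]) ρ, w v + δ * ‖v‖ ^ 2 ≤ w y + δ * ‖y‖ ^ 2 := hmax
  have hyb : y ∈ ball (0 : ℍ[ℝ]) ρ := by
    rcases (mem_closedBall_zero_iff.1 hy).lt_or_eq with h | h
    · exact mem_ball_zero_iff.2 h
    · have h1 := hm y (mem_sphere_zero_iff_norm.2 h)
      have h2 := hmax' x hx
      rw [h] at h2
      nlinarith [mul_nonneg hδ0.le (sq_nonneg ‖x‖)]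
  have hev : ∀ᶠ t in 𝓝[≠] (0 : ℝ),
      ∑ j, (w (y + t • qe j) + w (y - t • qe j) - 2 * w y) / t ^ 2 ≤ -(8 * δ) := by
    have hnh : ∀ᶠ t in 𝓝 (0 : ℝ), ∀ j,
        y + t • qe j ∈ ball (0 : ℍ[ℝ]) ρ ∧ y - t • qe j ∈ ball (0 : ℍ[ℝ]) ρ := by
      rw [eventually_all]
      intro j
      have c1 : Tendsto (fun t : ℝ => y + t • qe j) (𝓝 0) (𝓝 y) := by
        have : Continuous fun t : ℝ => y + t • qe j := by fun_prop
        simpa using this.tendsto 0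
      have c2 : Tendsto (fun t : ℝ => y - t • qe j) (𝓝 0) (𝓝 y) := by
        have : Continuous fun t : ℝ => y - t • qe j := by fun_prop
        simpa using this.tendsto 0
      exact (c1.eventually (isOpen_ball.mem_nhds hyb)).and
        (c2.eventually (isOpen_ball.mem_nhds hyb))
    filter_upwards [nhdsWithin_le_nhds hnh, self_mem_nhdsWithin] with t ht ht0
    have ht2 : 0 < t ^ 2 := by have : t ≠ 0 := ht0; positivity
    have key : ∀ j, (w (y + t • qe j) + w (y - t • qe j) - 2 * w y) / t ^ 2 ≤ -(2 * δ) := by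
      intro j
      rw [div_le_iff₀ ht2]
      have a1 := hmax' _ (ball_subset_closedBall (ht j).1)
      have a2 := hmax' _ (ball_subset_closedBall (ht j).2)
      have par := parallelogram_law_with_norm ℝ y (t • qe j)
      rw [norm_smul, norm_qe, mul_one] at par
      have par2 : ‖y + t • qe j‖ ^ 2 + ‖y - t • qe j‖ ^ 2 = 2 * (‖y‖ ^ 2 + t ^ 2) := by
        rw [← sq_abs t, ← Real.norm_eq_abs]; linarith
      nlinarith
    calc _ ≤ ∑ _j : Fin 4, -(2 * δ) := Finset.sum_le_sum fun j _ => key j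
      _ = -(8 * δ) := by simp; ring
  have := le_of_tendsto (hw y hyb) hev
  linarith

theorem exists_linearIsometryEquiv_apply_eq {v w : ℍ[ℝ]} (h : ‖v‖ = ‖w‖) :
    ∃ T : ℍ[ℝ] ≃ₗᵢ[ℝ] ℍ[ℝ], T v = w :=
  ⟨_, Submodule.reflection_sub h⟩

theorem pker_map (T : ℍ[ℝ] ≃ₗᵢ[ℝ] ℍ[ℝ]) (x ξ : ℍ[ℝ]) : pker (T x) (T ξ) = pker x ξ := by
  simp only [pker, ← map_sub, LinearIsometryEquiv.norm_map]

/-- Second differences of a `C²` function are quadratically small, locally uniformly. -/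
theorem exists_second_difference_bound {E : Type*} [NormedAddCommGroup E]
    [NormedSpace ℝ E] [ProperSpace E] {u : E → ℝ} (hu : ContDiffOn ℝ 2 u (ball 0 1)) {ρ : ℝ}
    (hρ : ρ < 1) : ∃ C, ∀ (y e : E) (t : ℝ), ‖y‖ + |t| ≤ ρ → ‖e‖ = 1 →
      |u (y + t • e) + u (y - t • e) - 2 * u y| ≤ C * t ^ 2 := by
  have hd : DifferentiableOn ℝ u (ball 0 1) := hu.differentiableOn (by norm_num)
  have hsub : closedBall (0 : E) ρ ⊆ ball 0 1 := closedBall_subset_ball hρ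
  have h1 : ContDiffOn ℝ 1 (fderiv ℝ u) (ball 0 1) :=
    hu.fderiv_of_isOpen isOpen_ball (by norm_num)
  have hd1 : DifferentiableOn ℝ (fderiv ℝ u) (ball 0 1) := h1.differentiableOn (by norm_num)
  have h2 : ContinuousOn (fderiv ℝ (fderiv ℝ u)) (ball 0 1) :=
    h1.continuousOn_fderiv_of_isOpen isOpen_ball (by norm_num)
  obtain ⟨K, hK⟩ := (isCompact_closedBall (0 : E) ρ).exists_bound_of_continuousOn
    (f := fderiv ℝ (fderiv ℝ u)) (h2.mono hsub)
  have hlip : ∀ a ∈ closedBall (0 : E) ρ, ∀ b ∈ closedBall (0 : E) ρ,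
      ‖fderiv ℝ u b - fderiv ℝ u a‖ ≤ K * ‖b - a‖ := fun a ha b hb =>
    (convex_closedBall (0 : E) ρ).norm_image_sub_le_of_norm_fderiv_le
      (fun x hx => hd1.differentiableAt (isOpen_ball.mem_nhds (hsub hx))) hK ha hb
  refine ⟨2 * K, fun y e t hyt he => ?_⟩
  have hy : y ∈ closedBall (0 : E) ρ := by
    rw [mem_closedBall_zero_iff]; linarith [abs_nonneg t]
  have hK0 : 0 ≤ K := (norm_nonneg _).trans (hK y hy)
  have hin : ∀ v, ‖v‖ ≤ |t| → y + v ∈ closedBall (0 : E) ρ := fun v hv => by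
    rw [mem_closedBall_zero_iff]; linarith [norm_add_le y v]
  have main : ∀ v, ‖v‖ ≤ |t| → |u (y + v) - u y - fderiv ℝ u y v| ≤ K * t ^ 2 := by
    intro v hv
    have hball : ∀ x ∈ closedBall y |t|, x ∈ closedBall (0 : E) ρ := fun x hx => by
      have := hin (x - y) (by rwa [← dist_eq_norm])
      simpa using this
    have := (convex_closedBall y |t|).norm_image_sub_le_of_norm_fderiv_le'
      (f := u) (φ := fderiv ℝ u y) (C := K * |t|) (x := y) (y := y + v)
      (fun x hx => hd.differentiableAt (isOpen_ball.mem_nhds (hsub (hball x hx))))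
      (fun x hx => (hlip y hy x (hball x hx)).trans
        (mul_le_mul_of_nonneg_left (by rwa [← dist_eq_norm]) hK0))
      (by simp) (by simpa using hv)
    rw [add_sub_cancel_left, Real.norm_eq_abs] at this
    calc _ ≤ K * |t| * ‖v‖ := this
      _ ≤ K * |t| * |t| := by gcongr
      _ = K * t ^ 2 := by rw [mul_assoc, abs_mul_abs_self, sq]
  have ht : ‖t • e‖ ≤ |t| := by rw [norm_smul, he, mul_one, Real.norm_eq_abs]
  have m1 := abs_le.1 (main (t • e) ht)
  have m2 := abs_le.1 (main (-(t • e)) (by rwa [norm_neg]))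
  rw [map_neg, ← sub_eq_add_neg] at m2
  rw [abs_le]
  constructor <;> linarith [m1.1, m1.2, m2.1, m2.2]

theorem norm_sub_pos_of_mem {x ξ : ℍ[ℝ]} (hx : ‖x‖ < 1) (hξ : ‖ξ‖ = 1) : 0 < ‖x - ξ‖ := by
  rw [norm_pos_iff, sub_ne_zero]
  rintro rfl
  linarith

theorem contDiffOn_pker {ξ : ℍ[ℝ]} (hξ : ‖ξ‖ = 1) :
    ContDiffOn ℝ 2 (fun x => pker x ξ) (ball 0 1) := by
  have : ∀ x : ℍ[ℝ], pker x ξ = (1 - ‖x‖ ^ 2) / (‖x - ξ‖ ^ 2) ^ 2 := fun x => by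
    rw [pker, ← pow_mul]
  simp only [this]
  refine ContDiffOn.div ?_ ?_ ?_
  · exact (contDiff_const.sub (contDiff_norm_sq ℝ)).contDiffOn
  · exact (((contDiff_norm_sq ℝ).comp (contDiff_id.sub contDiff_const)).pow 2).contDiffOn
  · intro x hx
    have := norm_sub_pos_of_mem (mem_ball_zero_iff.1 hx) hξ
    positivity

theorem exists_pker_second_difference_bound {ρ : ℝ} (hρ : ρ < 1) :
    ∃ C, ∀ (ξ y e : ℍ[ℝ]) (t : ℝ), ‖ξ‖ = 1 → ‖y‖ + |t| ≤ ρ → ‖e‖ = 1 →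
      |pker (y + t • e) ξ + pker (y - t • e) ξ - 2 * pker y ξ| ≤ C * t ^ 2 := by
  obtain ⟨C, hC⟩ := exists_second_difference_bound (contDiffOn_pker (ξ := 1) (by simp)) hρ
  refine ⟨C, fun ξ y e t hξ hyt he => ?_⟩
  obtain ⟨T, hT⟩ := exists_linearIsometryEquiv_apply_eq (v := ξ) (w := 1) (by simpa using hξ)
  have := hC (T y) (T e) t (by simpa using hyt) (by simpa using he)
  rwa [← map_smul, ← map_add, ← map_sub, ← hT, pker_map, pker_map, pker_map] at this

theorem sum_inner_qe (x y : ℍ[ℝ]) :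
    ∑ j, inner ℝ x (qe j) * inner ℝ y (qe j) = inner ℝ x y := by
  simp [Fin.sum_univ_four, Quaternion.inner_def, qe]

/-- The Poisson kernel is harmonic in its first argument. -/
theorem weakHarmonicAt_pker {x ξ : ℍ[ℝ]} (hx : ‖x‖ < 1) (hξ : ‖ξ‖ = 1) :
    WeakHarmonicAt (fun y => pker y ξ) x := by
  have hB0 : ‖x - ξ‖ ^ 2 ≠ 0 := by have := norm_sub_pos_of_mem hx hξ; positivity
  set a : ℝ := 1 - ‖x‖ ^ 2 with ha
  set B : ℝ := ‖x - ξ‖ ^ 2 with hB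
  set b : Fin 4 → ℝ := fun j => inner ℝ x (qe j) with hb
  set d : Fin 4 → ℝ := fun j => inner ℝ (x - ξ) (qe j) with hd
  have hform : ∀ j (t : ℝ), pker (x + t • qe j) ξ =
      (a - 2 * b j * t - t ^ 2) / (B + 2 * d j * t + t ^ 2) ^ 2 := by
    intro j t
    have e1 : ∀ v : ℍ[ℝ], ‖v + t • qe j‖ ^ 2 = ‖v‖ ^ 2 + 2 * inner ℝ v (qe j) * t + t ^ 2 := by
      intro v
      rw [norm_add_sq_real, inner_smul_right, norm_smul, norm_qe, mul_one, Real.norm_eq_abs,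
        sq_abs]
      ring
    rw [pker, show ‖x + t • qe j - ξ‖ ^ 4 = (‖x - ξ + t • qe j‖ ^ 2) ^ 2 by
      rw [← pow_mul, add_sub_right_comm], e1, e1]
    congr 1
    simp only [ha, hb]; ring
  have hlim : ∀ j, Tendsto (fun t : ℝ =>
      (pker (x + t • qe j) ξ + pker (x - t • qe j) ξ - 2 * pker x ξ) / t ^ 2) (𝓝[≠] 0)
      (𝓝 (-2 / B ^ 2 + 16 * (b j * d j) / B ^ 3 - 4 * a / B ^ 3 + 24 * a * (d j * d j) / B ^ 4)) := by
    intro j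
    have hDc : ContinuousAt (fun t : ℝ => B + 2 * d j * t + t ^ 2) 0 := by fun_prop
    have hDne : ∀ᶠ t in 𝓝 (0 : ℝ), B + 2 * d j * t + t ^ 2 ≠ 0 :=
      hDc.eventually_ne (by simpa using hB0)
    have hN' : ∀ t : ℝ, HasDerivAt (fun t : ℝ => a - 2 * b j * t - t ^ 2) (-2 * b j - 2 * t) t := by
      intro t
      refine ((((hasDerivAt_id t).const_mul (2 * b j)).const_sub a).sub
        (hasDerivAt_pow 2 t)).congr_deriv ?_
      simp
    have hD' : ∀ t : ℝ, HasDerivAt (fun t : ℝ => B + 2 * d j * t + t ^ 2) (2 * d j + 2 * t) t := by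
      intro t
      refine ((((hasDerivAt_id t).const_mul (2 * d j)).const_add B).add
        (hasDerivAt_pow 2 t)).congr_deriv ?_
      simp
    have hNN : HasDerivAt (fun t : ℝ => -2 * b j - 2 * t) (-2) 0 := by
      refine (((hasDerivAt_id (0 : ℝ)).const_mul 2).const_sub (-2 * b j)).congr_deriv ?_
      simp
    have hDD : HasDerivAt (fun t : ℝ => 2 * d j + 2 * t) 2 0 := by
      refine (((hasDerivAt_id (0 : ℝ)).const_mul 2).const_add (2 * d j)).congr_deriv ?_
      simp
    have := tendsto_second_difference (φ := fun t => pker (x + t • qe j) ξ)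
      (φ' := fun t => ((-2 * b j - 2 * t) * (B + 2 * d j * t + t ^ 2) -
        2 * ((a - 2 * b j * t - t ^ 2) * (2 * d j + 2 * t))) / (B + 2 * d j * t + t ^ 2) ^ 3)
      (L := -2 / B ^ 2 + 16 * (b j * d j) / B ^ 3 - 4 * a / B ^ 3 + 24 * a * (d j * d j) / B ^ 4) ?_ ?_
    · simpa [sub_eq_add_neg] using this
    · simp only [hform]
      filter_upwards [hDne] with t ht
      refine ((hN' t).div ((hD' t).pow 2) (pow_ne_zero 2 ht)).congr_deriv ?_
      simp only [Pi.pow_apply]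
      generalize B + 2 * d j * t + t ^ 2 = D at ht ⊢
      field_simp
      ring
    · have hD0 : (B + 2 * d j * 0 + 0 ^ 2) ^ 3 ≠ 0 := by simpa using hB0
      refine ((((hNN.mul (hD' 0)).sub (((hN' 0).mul hDD).const_mul 2))).div
        ((hD' 0).pow 3) hD0).congr_deriv ?_
      simp
      field_simp
      ring
  have hsum := tendsto_finsetSum Finset.univ fun j _ => hlim j
  refine hsum.trans_eq ?_
  congr 1
  have s1 : ∑ j, b j * d j = inner ℝ x (x - ξ) := sum_inner_qe _ _
  have s2 : ∑ j, d j * d j = B := by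
    rw [hB, ← real_inner_self_eq_norm_sq]; exact sum_inner_qe _ _
  simp only [Finset.sum_add_distrib, Finset.sum_sub_distrib, ← Finset.sum_div, ← Finset.mul_sum,
    s1, s2]
  have hB2 : B = 2 * inner ℝ x (x - ξ) + a := by
    rw [hB, ha, norm_sub_sq_real, hξ, inner_sub_right, real_inner_self_eq_norm_sq]; ring
  simp
  field_simp
  rw [hB2]; ring

theorem pker_nonneg {x ξ : ℍ[ℝ]} (hx : ‖x‖ < 1) : 0 ≤ pker x ξ := by
  have : 0 ≤ 1 - ‖x‖ ^ 2 := by nlinarith [norm_nonneg x]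
  exact div_nonneg this (by positivity)

theorem pker_le_of_le_norm_sub {x ξ : ℍ[ℝ]} {δ : ℝ} (hx : ‖x‖ < 1) (hδ : 0 < δ)
    (h : δ ≤ ‖x - ξ‖) : pker x ξ ≤ (1 - ‖x‖ ^ 2) / δ ^ 4 := by
  have : 0 ≤ 1 - ‖x‖ ^ 2 := by nlinarith [norm_nonneg x]
  unfold pker
  gcongr

theorem abs_pker_le {x ξ : ℍ[ℝ]} {ρ : ℝ} (hρ : ρ < 1) (hx : ‖x‖ ≤ ρ) (hξ : ‖ξ‖ = 1) :
    |pker x ξ| ≤ 1 / (1 - ρ) ^ 4 := by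
  have h1 : 1 - ρ ≤ ‖x - ξ‖ := by
    have := norm_sub_norm_le ξ x
    rw [norm_sub_rev] at this
    linarith
  rw [abs_of_nonneg (pker_nonneg (hx.trans_lt hρ))]
  refine (pker_le_of_le_norm_sub (hx.trans_lt hρ) (sub_pos.2 hρ) h1).trans ?_
  gcongr
  nlinarith [sq_nonneg ‖x‖]

theorem measurable_pker (x : ℍ[ℝ]) : Measurable (pker x) := by
  unfold pker
  fun_prop

theorem pker_zero {ξ : ℍ[ℝ]} (hξ : ‖ξ‖ = 1) : pker 0 ξ = 1 := by
  simp [pker, hξ]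

theorem integral_comp_linearIsometryEquiv {ψ : Measure ℍ[ℝ]}
    (hrot : ∀ T : ℍ[ℝ] ≃ₗᵢ[ℝ] ℍ[ℝ], ψ.map T = ψ)
    (T : ℍ[ℝ] ≃ₗᵢ[ℝ] ℍ[ℝ]) (F : ℍ[ℝ] → ℝ) : ∫ ξ, F (T ξ) ∂ψ = ∫ ξ, F ξ ∂ψ := by
  conv_rhs => rw [← hrot T]
  exact (MeasurableEmbedding.integral_map T.toHomeomorph.measurableEmbedding F).symm

section PoissonIntegral

variable {ψ : Measure ℍ[ℝ]} [IsProbabilityMeasure ψ] {φ : ℍ[ℝ] → ℝ} {M : ℝ}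

theorem integrable_mul_pker (hS : ∀ᵐ ξ ∂ψ, ‖ξ‖ = 1) (hφ : AEStronglyMeasurable φ ψ)
    (hM : ∀ᵐ ξ ∂ψ, |φ ξ| ≤ M) {x : ℍ[ℝ]} (hx : ‖x‖ < 1) :
    Integrable (fun ξ => φ ξ * pker x ξ) ψ := by
  refine Integrable.of_bound (hφ.mul (measurable_pker x).aestronglyMeasurable)
    (M * (1 / (1 - ‖x‖) ^ 4)) ?_
  filter_upwards [hS, hM] with ξ h1 h2
  rw [Real.norm_eq_abs, abs_mul]
  exact mul_le_mul h2 (abs_pker_le hx le_rfl h1) (abs_nonneg _) ((abs_nonneg _).trans h2)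

theorem continuousOn_integral_mul_pker (hS : ∀ᵐ ξ ∂ψ, ‖ξ‖ = 1) (hφ : AEStronglyMeasurable φ ψ)
    (hM : ∀ᵐ ξ ∂ψ, |φ ξ| ≤ M) {ρ : ℝ} (hρ : ρ < 1) :
    ContinuousOn (fun x => ∫ ξ, φ ξ * pker x ξ ∂ψ) (closedBall 0 ρ) := by
  refine continuousOn_of_dominated (bound := fun _ => M * (1 / (1 - ρ) ^ 4))
    (fun x _ => hφ.mul (measurable_pker x).aestronglyMeasurable) ?_ (integrable_const _) ?_
  · intro x hx
    filter_upwards [hS, hM] with ξ h1 h2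
    rw [Real.norm_eq_abs, abs_mul]
    exact mul_le_mul h2 (abs_pker_le hρ (mem_closedBall_zero_iff.1 hx) h1) (abs_nonneg _)
      ((abs_nonneg _).trans h2)
  · filter_upwards [hS] with ξ h1
    exact continuousOn_const.mul ((contDiffOn_pker h1).continuousOn.mono (closedBall_subset_ball hρ))

theorem weakHarmonicAt_integral_mul_pker (hS : ∀ᵐ ξ ∂ψ, ‖ξ‖ = 1) (hφ : AEStronglyMeasurable φ ψ)
    (hM : ∀ᵐ ξ ∂ψ, |φ ξ| ≤ M) {x : ℍ[ℝ]} (hx : ‖x‖ < 1) :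
    WeakHarmonicAt (fun x => ∫ ξ, φ ξ * pker x ξ ∂ψ) x := by
  obtain ⟨ρ, hxρ, hρ⟩ := exists_between hx
  obtain ⟨C, hC⟩ := exists_pker_second_difference_bound hρ
  set F : ℝ → ℍ[ℝ] → ℝ := fun t ξ =>
    φ ξ * ∑ j, (pker (x + t • qe j) ξ + pker (x - t • qe j) ξ - 2 * pker x ξ) / t ^ 2 with hF
  have hsmall : ∀ᶠ t in 𝓝 (0 : ℝ), |t| < ρ - ‖x‖ := by
    have : ball (0 : ℝ) (ρ - ‖x‖) ∈ 𝓝 (0 : ℝ) := ball_mem_nhds _ (sub_pos.2 hxρ)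
    filter_upwards [this] with t ht
    simpa using ht
  have hlim : Tendsto (fun t => ∫ ξ, F t ξ ∂ψ) (𝓝[≠] 0) (𝓝 (∫ _ξ, (0 : ℝ) ∂ψ)) := by
    refine tendsto_integral_filter_of_dominated_convergence (fun _ => M * (4 * C)) ?_ ?_
      (integrable_const _) ?_
    · refine Eventually.of_forall fun t => hφ.mul (Measurable.aestronglyMeasurable ?_)
      refine Finset.measurable_sum _ fun j _ => ?_
      exact (((measurable_pker _).add (measurable_pker _)).sub
        ((measurable_pker _).const_mul 2)).div_const _
    · filter_upwards [nhdsWithin_le_nhds hsmall, self_mem_nhdsWithin] with t ht ht0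
      have ht2 : 0 < t ^ 2 := by have : t ≠ 0 := ht0; positivity
      filter_upwards [hS, hM] with ξ h1 h2
      rw [Real.norm_eq_abs, hF, abs_mul]
      refine mul_le_mul h2 ?_ (abs_nonneg _) ((abs_nonneg _).trans h2)
      calc _ ≤ ∑ j, |(pker (x + t • qe j) ξ + pker (x - t • qe j) ξ - 2 * pker x ξ) / t ^ 2| :=
            Finset.abs_sum_le_sum_abs _ _
        _ ≤ ∑ _j : Fin 4, C := Finset.sum_le_sum fun j _ => by
            rw [abs_div, abs_of_pos ht2, div_le_iff₀ ht2]
            exact hC ξ x (qe j) t h1 (by linarith) (norm_qe j)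
        _ = 4 * C := by simp
    · filter_upwards [hS] with ξ h1
      simpa using (weakHarmonicAt_pker hx h1).const_mul (φ ξ)
  rw [integral_zero] at hlim
  refine hlim.congr' ?_
  filter_upwards [nhdsWithin_le_nhds hsmall] with t ht
  have hp : ∀ j, ‖x + t • qe j‖ < 1 := fun j => by
    have := norm_add_le x (t • qe j)
    rw [norm_smul, norm_qe, mul_one, Real.norm_eq_abs] at this
    linarith
  have hm : ∀ j, ‖x - t • qe j‖ < 1 := fun j => by
    have := norm_sub_le x (t • qe j)
    rw [norm_smul, norm_qe, mul_one, Real.norm_eq_abs] at this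
    linarith
  have hi : ∀ y : ℍ[ℝ], ‖y‖ < 1 → Integrable (fun ξ => φ ξ * pker y ξ) ψ := fun y hy =>
    integrable_mul_pker hS hφ hM hy
  have hFe : ∀ ξ, F t ξ = ∑ j, (φ ξ * pker (x + t • qe j) ξ + φ ξ * pker (x - t • qe j) ξ -
      2 * (φ ξ * pker x ξ)) / t ^ 2 := fun ξ => by
    rw [hF]
    simp only
    rw [Finset.mul_sum]
    exact Finset.sum_congr rfl fun j _ => by ring
  have hadd : ∀ j, Integrable (fun ξ => φ ξ * pker (x + t • qe j) ξ + φ ξ * pker (x - t • qe j) ξ)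
      ψ := fun j => (hi _ (hp j)).add (hi _ (hm j))
  have hall : ∀ j ∈ Finset.univ, Integrable (fun ξ => (φ ξ * pker (x + t • qe j) ξ +
      φ ξ * pker (x - t • qe j) ξ - 2 * (φ ξ * pker x ξ)) / t ^ 2) ψ :=
    fun j _ => ((hadd j).sub ((hi x hx).const_mul 2)).div_const _
  simp only [hFe]
  rw [integral_finsetSum _ hall]
  refine Finset.sum_congr rfl fun j _ => ?_
  rw [integral_div, integral_sub (hadd j) ((hi x hx).const_mul 2),
    integral_add (hi _ (hp j)) (hi _ (hm j)), integral_const_mul]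

theorem integral_pker (hS : ∀ᵐ ξ ∂ψ, ‖ξ‖ = 1)
    (hrot : ∀ T : ℍ[ℝ] ≃ₗᵢ[ℝ] ℍ[ℝ], ψ.map T = ψ) {x : ℍ[ℝ]} (hx : ‖x‖ < 1) :
    ∫ ξ, pker x ξ ∂ψ = 1 := by
  set N : ℍ[ℝ] → ℝ := fun y => ∫ ξ, (fun _ => (1 : ℝ)) ξ * pker y ξ ∂ψ with hN
  have hm : AEStronglyMeasurable (fun _ : ℍ[ℝ] => (1 : ℝ)) ψ := aestronglyMeasurable_const
  have hb : ∀ᵐ ξ ∂ψ, |(fun _ : ℍ[ℝ] => (1 : ℝ)) ξ| ≤ 1 := by simp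
  have hrad : ∀ y, ‖y‖ = ‖x‖ → N y = N x := by
    intro y hy
    obtain ⟨T, hT⟩ := exists_linearIsometryEquiv_apply_eq hy
    have := integral_comp_linearIsometryEquiv hrot T (fun ξ => (1 : ℝ) * pker (T y) ξ)
    simp only [pker_map] at this
    rw [hN]
    simp only
    rw [this, hT]
  have hc := continuousOn_integral_mul_pker hS hm hb hx
  have hh : ∀ y ∈ ball (0 : ℍ[ℝ]) ‖x‖, WeakHarmonicAt N y := fun y hy =>
    weakHarmonicAt_integral_mul_pker hS hm hb ((mem_ball_zero_iff.1 hy).trans hx)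
  have h0 : (0 : ℍ[ℝ]) ∈ closedBall (0 : ℍ[ℝ]) ‖x‖ := by simp
  have h1 : N 0 ≤ N x := WeakHarmonicAt.le_of_sphere_le hc hh
    (fun y hy => (hrad y (mem_sphere_zero_iff_norm.1 hy)).le) h0
  have h2 : -N 0 ≤ -N x := WeakHarmonicAt.le_of_sphere_le hc.neg (fun y hy => (hh y hy).neg)
    (fun y hy => neg_le_neg (hrad y (mem_sphere_zero_iff_norm.1 hy)).ge) h0
  have h3 : N 0 = 1 := by
    have : N 0 = ∫ _ξ, (1 : ℝ) ∂ψ := by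
      refine integral_congr_ae ?_
      filter_upwards [hS] with ξ hξ
      rw [pker_zero hξ, one_mul]
    simpa using this
  have h4 : ∫ ξ, pker x ξ ∂ψ = N x := by simp [hN]
  rw [h4]
  linarith

/-- Poisson's formula for weakly harmonic functions continuous up to the boundary. -/
theorem WeakHarmonicAt.eq_integral_mul_pker (hS : ∀ᵐ ξ ∂ψ, ‖ξ‖ = 1)
    (hrot : ∀ T : ℍ[ℝ] ≃ₗᵢ[ℝ] ℍ[ℝ], ψ.map T = ψ) {u : ℍ[ℝ] → ℝ}
    (hc : ContinuousOn u (closedBall 0 1)) (hu : ∀ x ∈ ball (0 : ℍ[ℝ]) 1, WeakHarmonicAt u x)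
    (hm : AEStronglyMeasurable u ψ) {x : ℍ[ℝ]} (hx : ‖x‖ < 1) :
    u x = ∫ ξ, u ξ * pker x ξ ∂ψ := by
  obtain ⟨M, hM⟩ := (isCompact_closedBall (0 : ℍ[ℝ]) 1).exists_bound_of_continuousOn hc
  have hM' : ∀ y : ℍ[ℝ], ‖y‖ ≤ 1 → |u y| ≤ M := fun y hy => hM y (mem_closedBall_zero_iff.2 hy)
  have hM0 : 0 ≤ M := (abs_nonneg _).trans (hM' x hx.le)
  have hb : ∀ᵐ ξ ∂ψ, |u ξ| ≤ M := hS.mono fun ξ hξ => hM' ξ hξ.le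
  set h : ℍ[ℝ] → ℝ := fun y => ∫ ξ, u ξ * pker y ξ ∂ψ with hh
  have hdiff : ∀ ε > 0, |u x - h x| ≤ ε := by
    intro ε hε
    obtain ⟨δ, hδ, hunif⟩ := Metric.uniformContinuousOn_iff.1
      ((isCompact_closedBall (0 : ℍ[ℝ]) 1).uniformContinuousOn_of_continuous hc) (ε / 2) (half_pos hε)
    have hev : ∀ᶠ ρ : ℝ in 𝓝[<] 1, 2 * M * ((1 - ρ ^ 2) / δ ^ 4) < ε / 2 := by
      have hct : Continuous fun ρ : ℝ => 2 * M * ((1 - ρ ^ 2) / δ ^ 4) := by fun_prop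
      refine nhdsWithin_le_nhds ((hct.tendsto 1).eventually_lt_const ?_)
      simpa using hε
    have hev2 : ∀ᶠ ρ : ℝ in 𝓝[<] 1, ρ ∈ Set.Ioo ‖x‖ 1 := Ioo_mem_nhdsLT hx
    obtain ⟨ρ, hρε, hxρ, hρ1⟩ := (hev.and hev2).exists
    have hsphere : ∀ y ∈ sphere (0 : ℍ[ℝ]) ρ, |u y - h y| ≤ ε := by
      intro y hy
      have hyn : ‖y‖ = ρ := mem_sphere_zero_iff_norm.1 hy
      have hy1 : ‖y‖ < 1 := hyn.trans_lt hρ1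
      have hpi : Integrable (fun ξ => pker y ξ) ψ := by
        simpa using integrable_mul_pker hS (φ := fun _ => (1 : ℝ)) (M := 1)
          aestronglyMeasurable_const (by simp) hy1
      have hui := integrable_mul_pker hS hm hb hy1
      have e1 : u y - h y = ∫ ξ, (u y * pker y ξ - u ξ * pker y ξ) ∂ψ := by
        rw [integral_sub (hpi.const_mul _) hui, integral_const_mul, integral_pker hS hrot hy1,
          mul_one]
      have e2 : ∀ᵐ ξ ∂ψ, ‖u y * pker y ξ - u ξ * pker y ξ‖ ≤ ε / 2 * pker y ξ + ε / 2 := by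
        filter_upwards [hS] with ξ hξ
        have hp0 := pker_nonneg (ξ := ξ) hy1
        rw [← sub_mul, Real.norm_eq_abs, abs_mul, abs_of_nonneg hp0]
        by_cases hd : dist y ξ < δ
        · have := hunif y (mem_closedBall_zero_iff.2 hy1.le) ξ (mem_closedBall_zero_iff.2 hξ.le) hd
          rw [Real.dist_eq] at this
          nlinarith
        · have hp1 := pker_le_of_le_norm_sub (ξ := ξ) hy1 hδ (by rw [← dist_eq_norm]; linarith)
          rw [hyn] at hp1
          have ha : |u y - u ξ| ≤ 2 * M := by
            have := abs_sub (u y) (u ξ)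
            linarith [hM' y hy1.le, hM' ξ hξ.le]
          have : |u y - u ξ| * pker y ξ ≤ 2 * M * ((1 - ρ ^ 2) / δ ^ 4) :=
            mul_le_mul ha hp1 hp0 (by linarith)
          nlinarith
      calc |u y - h y| ≤ ∫ ξ, (ε / 2 * pker y ξ + ε / 2) ∂ψ := by
            rw [e1, ← Real.norm_eq_abs]
            exact norm_integral_le_of_norm_le ((hpi.const_mul _).add (integrable_const _)) e2
        _ = ε := by
            rw [integral_add (hpi.const_mul _) (integrable_const _), integral_const_mul,
              integral_pker hS hrot hy1]
            simp
    have hwc : ContinuousOn (fun y => u y - h y) (closedBall 0 ρ) :=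
      (hc.mono (closedBall_subset_closedBall hρ1.le)).sub
        (continuousOn_integral_mul_pker hS hm hb hρ1)
    have hwh : ∀ y ∈ ball (0 : ℍ[ℝ]) ρ, WeakHarmonicAt (fun y => u y - h y) y := fun y hy =>
      (hu y (ball_subset_ball hρ1.le hy)).sub
        (weakHarmonicAt_integral_mul_pker hS hm hb ((mem_ball_zero_iff.1 hy).trans hρ1))
    have hxc : x ∈ closedBall (0 : ℍ[ℝ]) ρ := mem_closedBall_zero_iff.2 hxρ.le
    refine abs_le.2 ⟨?_, ?_⟩
    · exact neg_le.1 (WeakHarmonicAt.le_of_sphere_le hwc.neg (fun y hy => (hwh y hy).neg)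
        (fun y hy => neg_le.1 (abs_le.1 (hsphere y hy)).1) hxc)
    · exact WeakHarmonicAt.le_of_sphere_le hwc hwh (fun y hy => (abs_le.1 (hsphere y hy)).2) hxc
  have : |u x - h x| ≤ 0 := le_of_forall_pos_le_add fun ε hε => by simpa using hdiff ε hε
  exact sub_eq_zero.1 (abs_nonpos_iff.1 this)

/-- A rotation-invariant measure on the unit sphere does not charge hyperplanes. -/
theorem ae_re_map_ne_zero (hS : ∀ᵐ ξ ∂ψ, ‖ξ‖ = 1)
    (hrot : ∀ T : ℍ[ℝ] ≃ₗᵢ[ℝ] ℍ[ℝ], ψ.map T = ψ) (T : ℍ[ℝ] ≃ₗᵢ[ℝ] ℍ[ℝ]) :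
    ∀ᵐ ξ ∂ψ, (T ξ).re ≠ 0 := by
  set E : Set (ℍ[ℝ] × ℍ[ℝ]) := {p | inner ℝ p.1 p.2 = 0} with hE
  have hEm : MeasurableSet E :=
    (isClosed_eq (by fun_prop : Continuous fun p : ℍ[ℝ] × ℍ[ℝ] => inner ℝ p.1 p.2)
      continuous_const).measurableSet
  have hnull : ((volume : Measure ℍ[ℝ]).prod ψ) E = 0 := by
    rw [Measure.prod_apply_symm hEm, lintegral_eq_zero_iff (measurable_measure_prodMk_right hEm)]
    filter_upwards [hS] with ξ hξ
    have hne : (ℝ ∙ ξ)ᗮ ≠ ⊤ := by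
      rw [Ne, Submodule.orthogonal_eq_top_iff, Submodule.span_singleton_eq_bot]
      rintro rfl
      simp at hξ
    have hset : (fun v => (v, ξ)) ⁻¹' E = ((ℝ ∙ ξ)ᗮ : Submodule ℝ ℍ[ℝ]) := by
      ext v
      simp [hE, Submodule.mem_orthogonal_singleton_iff_inner_left]
    rw [hset]
    exact Measure.addHaar_submodule _ _ hne
  have hsec : ∀ᵐ v ∂(volume : Measure ℍ[ℝ]), ψ (Prod.mk v ⁻¹' E) = 0 :=
    Measure.measure_ae_null_of_prod_null hnull
  obtain ⟨v, hv⟩ := hsec.exists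
  have hT : ∀ᵐ ξ ∂ψ, inner ℝ v ξ ≠ 0 := measure_eq_zero_iff_ae_notMem.1 hv
  obtain ⟨S, hSv⟩ := exists_linearIsometryEquiv_apply_eq (v := v) (w := ‖v‖ • T.symm 1)
    (by simp [norm_smul])
  rw [← hrot S.symm] at hT
  filter_upwards [ae_of_ae_map S.symm.continuous.measurable.aemeasurable hT] with ξ hξ h0
  refine hξ ?_
  rw [← S.inner_map_map, S.apply_symm_apply, hSv, inner_smul_left, ← T.inner_map_map,
    T.apply_symm_apply]
  simp [Quaternion.inner_def, h0]

end PoissonIntegral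

theorem ContDiffOn.differentiableAt_fderiv_apply {E F : Type*} [NormedAddCommGroup E]
    [NormedSpace ℝ E] [NormedAddCommGroup F] [NormedSpace ℝ F] {f : E → F} {s : Set E} {x : E}
    (hf : ContDiffOn ℝ 2 f s) (hs : IsOpen s) (hx : x ∈ s) (v : E) :
    DifferentiableAt ℝ (fun w => fderiv ℝ f w v) x := by
  have h1 : ContDiffOn ℝ 1 (fderiv ℝ f) s := hf.fderiv_of_isOpen hs (by norm_num)
  exact ((h1.differentiableOn (by norm_num)).differentiableAt (hs.mem_nhds hx)).clm_apply
    (differentiableAt_const v)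

/-- Real components of dilates of a harmonic function are weakly harmonic. -/
theorem weakHarmonicAt_inner_comp_smul {f : ℍ[ℝ] → ℍ[ℝ]} (hf : ContDiffOn ℝ 2 f (ball 0 1))
    (hharm : ∀ z ∈ ball (0 : ℍ[ℝ]) 1, qLap f z = 0) (a : ℍ[ℝ]) {r : ℝ} {x : ℍ[ℝ]}
    (hx : r • x ∈ ball (0 : ℍ[ℝ]) 1) : WeakHarmonicAt (fun y => inner ℝ a (f (r • y))) x := by
  have hγ : ∀ (e : ℍ[ℝ]) (t : ℝ), HasDerivAt (fun t : ℝ => r • (x + t • e)) (r • e) t := by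
    intro e t
    have := (((hasDerivAt_id t).smul_const e).const_add x).const_smul r
    exact this.congr_deriv (by simp)
  have hev : ∀ e : ℍ[ℝ], ∀ᶠ t in 𝓝 (0 : ℝ), r • (x + t • e) ∈ ball (0 : ℍ[ℝ]) 1 := by
    intro e
    refine (hγ e 0).continuousAt.eventually_mem (isOpen_ball.mem_nhds ?_)
    simpa using hx
  have hd : ∀ y ∈ ball (0 : ℍ[ℝ]) 1, HasFDerivAt f (fderiv ℝ f y) y := fun y hy =>
    ((hf.differentiableOn (by norm_num)).differentiableAt (isOpen_ball.mem_nhds hy)).hasFDerivAt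
  have hlim : ∀ j, Tendsto (fun t : ℝ => (inner ℝ a (f (r • (x + t • qe j))) +
      inner ℝ a (f (r • (x - t • qe j))) - 2 * inner ℝ a (f (r • x))) / t ^ 2) (𝓝[≠] 0)
      (𝓝 (r ^ 2 * inner ℝ a (fderiv ℝ (fun w => fderiv ℝ f w (qe j)) (r • x) (qe j)))) := by
    intro j
    have := tendsto_second_difference
      (φ := fun t => inner ℝ a (f (r • (x + t • qe j))))
      (φ' := fun t => r * inner ℝ a (fderiv ℝ f (r • (x + t • qe j)) (qe j)))
      (L := r ^ 2 * inner ℝ a (fderiv ℝ (fun w => fderiv ℝ f w (qe j)) (r • x) (qe j))) ?_ ?_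
    · simpa [sub_eq_add_neg] using this
    · filter_upwards [hev (qe j)] with t ht
      have h1 := (hd _ ht).comp_hasDerivAt t (hγ (qe j) t)
      have h2 := (hasDerivAt_const t a).inner ℝ h1
      refine h2.congr_deriv ?_
      simp [inner_smul_right]
    · have h0 : r • (x + (0 : ℝ) • qe j) = r • x := by simp
      have h1 : HasFDerivAt (fun w => fderiv ℝ f w (qe j))
          (fderiv ℝ (fun w => fderiv ℝ f w (qe j)) (r • x)) (r • (x + (0 : ℝ) • qe j)) := by
        rw [h0]
        exact (hf.differentiableAt_fderiv_apply isOpen_ball hx (qe j)).hasFDerivAt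
      have h2 := h1.comp_hasDerivAt (0 : ℝ) (hγ (qe j) 0)
      have h3 := ((hasDerivAt_const (0 : ℝ) a).inner ℝ h2).const_mul r
      refine h3.congr_deriv ?_
      simp [inner_smul_right]
      ring
  refine (tendsto_finsetSum Finset.univ fun j _ => hlim j).trans_eq ?_
  rw [← Finset.mul_sum, ← inner_sum]
  have := hharm _ hx
  rw [qLap] at this
  rw [this, inner_zero_right, mul_zero]

theorem measurable_bdrySign : Measurable bdrySign := by
  unfold bdrySign Real.sign
  have : Measurable fun ξ : ℍ[ℝ] => ξ.re := Quaternion.continuous_re.measurable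
  exact Measurable.ite (measurableSet_lt this measurable_const) measurable_const
    (Measurable.ite (measurableSet_lt measurable_const this) measurable_const measurable_const)

theorem abs_bdrySign_le (ξ : ℍ[ℝ]) : |bdrySign ξ| ≤ 1 := by
  unfold bdrySign
  rcases Real.sign_apply_eq ξ.re with h | h | h <;> simp [h]

/-- The sign of `(T ξ).re` is the sign of the deviation of the Poisson kernel at `z` from its
value on the equator orthogonal to `z`. -/
theorem pker_sub_equator_spec {z : ℍ[ℝ]} (hz : ‖z‖ < 1) (hz0 : z ≠ 0) {T : ℍ[ℝ] ≃ₗᵢ[ℝ] ℍ[ℝ]}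
    (hT : T z = ((‖z‖ : ℝ) : ℍ[ℝ])) {ξ : ℍ[ℝ]} (hξ : ‖ξ‖ = 1) (hre : (T ξ).re ≠ 0) :
    bdrySign (T ξ) ^ 2 = 1 ∧ pker z ξ - (1 - ‖z‖ ^ 2) / (1 + ‖z‖ ^ 2) ^ 2 ≠ 0 ∧
      ∀ g : ℝ, |g| ≤ 1 →
        0 ≤ (bdrySign (T ξ) - g) * (pker z ξ - (1 - ‖z‖ ^ 2) / (1 + ‖z‖ ^ 2) ^ 2) := by
  have hR : 0 < ‖z‖ := norm_pos_iff.2 hz0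
  have hQ : ‖z - ξ‖ ^ 2 = 1 + ‖z‖ ^ 2 - 2 * (‖z‖ * (T ξ).re) := by
    rw [norm_sub_sq_real, hξ, ← T.inner_map_map, hT]
    simp [Quaternion.inner_def]
    ring
  have hQ0 : 0 < ‖z - ξ‖ ^ 2 := by have := norm_sub_pos_of_mem hz hξ; positivity
  have hp : pker z ξ = (1 - ‖z‖ ^ 2) / (‖z - ξ‖ ^ 2) ^ 2 := by rw [pker, ← pow_mul]
  have hN : 0 < 1 - ‖z‖ ^ 2 := by nlinarith
  rcases hre.lt_or_gt with h | h
  · have hs : bdrySign (T ξ) = -1 := Real.sign_of_neg h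
    have hlt : pker z ξ < (1 - ‖z‖ ^ 2) / (1 + ‖z‖ ^ 2) ^ 2 := by
      rw [hp]
      have : 1 + ‖z‖ ^ 2 < ‖z - ξ‖ ^ 2 := by nlinarith
      gcongr
    refine ⟨by simp [hs], (sub_neg.2 hlt).ne, fun g hg => ?_⟩
    rw [hs]
    exact mul_nonneg_of_nonpos_of_nonpos (by linarith [(abs_le.1 hg).1]) (sub_neg.2 hlt).le
  · have hs : bdrySign (T ξ) = 1 := Real.sign_of_pos h
    have hlt : (1 - ‖z‖ ^ 2) / (1 + ‖z‖ ^ 2) ^ 2 < pker z ξ := by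
      rw [hp]
      have : ‖z - ξ‖ ^ 2 < 1 + ‖z‖ ^ 2 := by nlinarith
      gcongr
    refine ⟨by simp [hs], (sub_pos.2 hlt).ne', fun g hg => ?_⟩
    rw [hs]
    exact mul_nonneg (by linarith [(abs_le.1 hg).2]) (sub_pos.2 hlt).le

theorem Upois_map {ψ : Measure ℍ[ℝ]} (hrot : ∀ T : ℍ[ℝ] ≃ₗᵢ[ℝ] ℍ[ℝ], ψ.map T = ψ)
    (T : ℍ[ℝ] ≃ₗᵢ[ℝ] ℍ[ℝ]) (x : ℍ[ℝ]) :
    Upois ψ (T x) = ∫ ξ, bdrySign (T ξ) * pker x ξ ∂ψ := by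
  rw [Upois, ← integral_comp_linearIsometryEquiv hrot T]
  simp only [pker_map]

theorem integral_bdrySign_map {ψ : Measure ℍ[ℝ]} (hrot : ∀ T : ℍ[ℝ] ≃ₗᵢ[ℝ] ℍ[ℝ], ψ.map T = ψ)
    (T : ℍ[ℝ] ≃ₗᵢ[ℝ] ℍ[ℝ]) : ∫ ξ, bdrySign (T ξ) ∂ψ = 0 := by
  have h := integral_comp_linearIsometryEquiv hrot (LinearIsometryEquiv.neg ℝ)
    fun ξ => bdrySign (T ξ)
  have hneg : ∀ ξ : ℍ[ℝ], bdrySign (T (-ξ)) = -bdrySign (T ξ) := fun ξ => by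
    simp [bdrySign, Real.sign_neg]
  simp only [LinearIsometryEquiv.coe_neg, hneg, integral_neg] at h
  linarith

theorem exists_norm_eq_one_inner_eq_norm (w : ℍ[ℝ]) : ∃ c : ℍ[ℝ], ‖c‖ = 1 ∧ inner ℝ c w = ‖w‖ := by
  obtain rfl | hw := eq_or_ne w 0
  · exact ⟨1, by simp⟩
  · have hw' : ‖w‖ ≠ 0 := norm_ne_zero_iff.2 hw
    refine ⟨‖w‖⁻¹ • w, by rw [norm_smul, norm_inv, norm_norm, inv_mul_cancel₀ hw'], ?_⟩
    rw [inner_smul_left, real_inner_self_eq_norm_sq]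
    simp
    field_simp

/-- A nonnegative sequence of functions with integrals tending to zero has a subsequence
converging to zero almost everywhere. -/
theorem exists_seq_tendsto_zero_ae_of_tendsto_integral {α : Type*} [MeasurableSpace α]
    {μ : Measure α} {F : ℕ → α → ℝ} (hF : ∀ n, Integrable (F n) μ) (h0 : ∀ n, 0 ≤ᵐ[μ] F n)
    (hlim : Tendsto (fun n => ∫ a, F n a ∂μ) atTop (𝓝 0)) :
    ∃ ns : ℕ → ℕ, StrictMono ns ∧ ∀ᵐ a ∂μ, Tendsto (fun i => F (ns i) a) atTop (𝓝 0) := by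
  refine TendstoInMeasure.exists_seq_tendsto_ae (g := fun _ => 0)
    (tendstoInMeasure_of_tendsto_eLpNorm one_ne_zero (fun n => (hF n).aestronglyMeasurable)
      aestronglyMeasurable_const ?_)
  have : ∀ n, eLpNorm (F n - fun _ => 0) 1 μ = ENNReal.ofReal (∫ a, F n a ∂μ) := by
    intro n
    rw [eLpNorm_one_eq_lintegral_enorm, ofReal_integral_eq_lintegral_ofReal (hF n) (h0 n)]
    refine lintegral_congr_ae ?_
    filter_upwards [h0 n] with a ha
    simpa using Real.enorm_of_nonneg ha
  simp only [this]
  simpa using ENNReal.tendsto_ofReal hlim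

/-- Poisson's formula for the real components of dilates of a harmonic function. -/
theorem inner_comp_smul_eq_integral {ψ : Measure ℍ[ℝ]} [IsProbabilityMeasure ψ]
    (hS : ∀ᵐ ξ ∂ψ, ‖ξ‖ = 1) (hrot : ∀ T : ℍ[ℝ] ≃ₗᵢ[ℝ] ℍ[ℝ], ψ.map T = ψ)
    {f : ℍ[ℝ] → ℍ[ℝ]} (hf : ContDiffOn ℝ 2 f (ball 0 1))
    (hharm : ∀ z ∈ ball (0 : ℍ[ℝ]) 1, qLap f z = 0) (a : ℍ[ℝ]) {r : ℝ} (hr0 : 0 ≤ r) (hr1 : r < 1) :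
    AEStronglyMeasurable (fun ξ => inner ℝ a (f (r • ξ))) ψ ∧ ∀ x : ℍ[ℝ], ‖x‖ < 1 →
      inner ℝ a (f (r • x)) = ∫ ξ, inner ℝ a (f (r • ξ)) * pker x ξ ∂ψ := by
  have hmem : ∀ x : ℍ[ℝ], ‖x‖ ≤ 1 → r • x ∈ ball (0 : ℍ[ℝ]) 1 := fun x hx => by
    rw [mem_ball_zero_iff, norm_smul, Real.norm_of_nonneg hr0]
    nlinarith [norm_nonneg x]
  have hc : ContinuousOn (fun x => inner ℝ a (f (r • x))) (closedBall 0 1) :=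
    continuousOn_const.inner (hf.continuousOn.comp (continuous_const_smul r).continuousOn
      fun x hx => hmem x (mem_closedBall_zero_iff.1 hx))
  have hm : AEStronglyMeasurable (fun ξ => inner ℝ a (f (r • ξ))) ψ := by
    have h1 : ψ.restrict (closedBall 0 1) = ψ :=
      Measure.restrict_eq_self_of_ae_mem (hS.mono fun ξ hξ => mem_closedBall_zero_iff.2 hξ.le)
    rw [← h1]
    exact hc.aestronglyMeasurable isClosed_closedBall.measurableSet
  exact ⟨hm, fun x hx => WeakHarmonicAt.eq_integral_mul_pker hS hrot hc
    (fun y hy => weakHarmonicAt_inner_comp_smul hf hharm a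
      (hmem y (mem_ball_zero_iff.1 hy).le)) hm hx⟩

/-- Equality case of the Schwarz-type bound: if a harmonic `f : B → ℍ` with `f(0) = 0`
and `|f| ≤ 1` satisfies `|f(z)| = U(|z|·1)` at some nonzero `z ∈ B`, then
`f = c·(U ∘ T)` for some unit quaternion `c` and some ℝ-linear isometry `T` of `ℍ ≅ ℝ⁴`. -/
theorem harmonic_schwarz_equality_case
    (ψ : Measure ℍ[ℝ]) (hψone : ψ (sphere (0 : ℍ[ℝ]) 1) = 1)
    (hψsupp : ψ (sphere (0 : ℍ[ℝ]) 1)ᶜ = 0)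
    (hψrot : ∀ T : ℍ[ℝ] ≃ₗᵢ[ℝ] ℍ[ℝ], ψ.map T = ψ)
    (f : ℍ[ℝ] → ℍ[ℝ]) (hf : ContDiffOn ℝ 2 f (ball 0 1))
    (hharm : ∀ z ∈ ball (0 : ℍ[ℝ]) 1, qLap f z = 0)
    (hf0 : f 0 = 0) (hbd : ∀ z ∈ ball (0 : ℍ[ℝ]) 1, ‖f z‖ ≤ 1)
    (z : ℍ[ℝ]) (hz : z ∈ ball (0 : ℍ[ℝ]) 1) (hz0 : z ≠ 0)
    (heq : ‖f z‖ = Upois ψ ((‖z‖ : ℝ) : ℍ[ℝ])) :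
    ∃ (c : ℍ[ℝ]) (T : ℍ[ℝ] ≃ₗᵢ[ℝ] ℍ[ℝ]), ‖c‖ = 1 ∧
      ∀ x ∈ ball (0 : ℍ[ℝ]) 1, f x = c * ((Upois ψ (T x) : ℝ) : ℍ[ℝ]) := by
  have hS : ∀ᵐ ξ ∂ψ, ‖ξ‖ = 1 := by
    filter_upwards [measure_eq_zero_iff_ae_notMem.1 hψsupp] with ξ hξ
    simpa using hξ
  have hprob : IsProbabilityMeasure ψ := ⟨by
    rw [← measure_add_measure_compl (isClosed_sphere (x := (0 : ℍ[ℝ])) (ε := 1)).measurableSet,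
      hψone, hψsupp, add_zero]⟩
  have hz1 : ‖z‖ < 1 := mem_ball_zero_iff.1 hz
  obtain ⟨c, hc1, hcz⟩ := exists_norm_eq_one_inner_eq_norm (f z)
  obtain ⟨T, hT⟩ := exists_linearIsometryEquiv_apply_eq (v := z) (w := ((‖z‖ : ℝ) : ℍ[ℝ])) (by simp)
  obtain ⟨r, -, hr, hrlim⟩ := exists_seq_strictMono_tendsto' (zero_lt_one' ℝ)
  have hmem : ∀ n (x : ℍ[ℝ]), ‖x‖ ≤ 1 → r n • x ∈ ball (0 : ℍ[ℝ]) 1 := fun n x hx => by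
    rw [mem_ball_zero_iff, norm_smul, Real.norm_of_nonneg (hr n).1.le]
    nlinarith [norm_nonneg x, (hr n).1, (hr n).2]
  have hpois := fun a n => inner_comp_smul_eq_integral hS hψrot hf hharm a (hr n).1.le (hr n).2
  have hdil : ∀ a x : ℍ[ℝ], ‖x‖ < 1 →
      Tendsto (fun n => inner ℝ a (f (r n • x))) atTop (𝓝 (inner ℝ a (f x))) := by
    intro a x hx
    have h1 : ContinuousAt f x :=
      hf.continuousOn.continuousAt (isOpen_ball.mem_nhds (mem_ball_zero_iff.2 hx))
    have h2 : Tendsto (fun n => r n • x) atTop (𝓝 x) := by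
      simpa using hrlim.smul_const x
    exact tendsto_const_nhds.inner (h1.tendsto.comp h2)
  have hbound : ∀ a n, ∀ᵐ ξ ∂ψ, |inner ℝ a (f (r n • ξ))| ≤ ‖a‖ := fun a n => by
    filter_upwards [hS] with ξ hξ
    have h1 := abs_real_inner_le_norm a (f (r n • ξ))
    have h2 := hbd _ (hmem n ξ hξ.le)
    nlinarith [norm_nonneg a]
  set lam : ℝ := (1 - ‖z‖ ^ 2) / (1 + ‖z‖ ^ 2) ^ 2 with hlam
  set D : ℍ[ℝ] → ℝ := fun ξ => pker z ξ - lam with hD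
  have hsm : AEStronglyMeasurable (fun ξ => bdrySign (T ξ)) ψ :=
    (measurable_bdrySign.comp T.continuous.measurable).aestronglyMeasurable
  have hsb : ∀ᵐ ξ ∂ψ, |bdrySign (T ξ)| ≤ 1 := ae_of_all _ fun ξ => abs_bdrySign_le _
  have hexp : ∀ φ : ℍ[ℝ] → ℝ, ∀ M, AEStronglyMeasurable φ ψ → (∀ᵐ ξ ∂ψ, |φ ξ| ≤ M) →
      Integrable (fun ξ => φ ξ * D ξ) ψ ∧
        ∫ ξ, φ ξ * D ξ ∂ψ = ∫ ξ, φ ξ * pker z ξ ∂ψ - (∫ ξ, φ ξ ∂ψ) * lam := by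
    intro φ M hm hM
    have h1 := integrable_mul_pker hS hm hM hz1
    have h2 : Integrable φ ψ := Integrable.of_bound hm M hM
    simp only [hD, mul_sub]
    exact ⟨h1.sub (h2.mul_const _), by
      rw [integral_sub h1 (h2.mul_const _), integral_mul_const]⟩
  set F : ℕ → ℍ[ℝ] → ℝ := fun n ξ => (bdrySign (T ξ) - inner ℝ c (f (r n • ξ))) * D ξ with hF
  have hsD := hexp _ 1 hsm hsb
  have hgD := fun n => hexp _ ‖c‖ (hpois c n).1 (hbound c n)
  have hFe : ∀ n, F n = fun ξ => bdrySign (T ξ) * D ξ - inner ℝ c (f (r n • ξ)) * D ξ := fun n => by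
    ext ξ
    simp only [hF, sub_mul]
  have hFi : ∀ n, Integrable (F n) ψ := fun n => by
    rw [hFe]
    exact hsD.1.sub (hgD n).1
  have hg0 : ∀ n, ∫ ξ, inner ℝ c (f (r n • ξ)) ∂ψ = 0 := by
    intro n
    have h1 := (hpois c n).2 0 (by simp)
    rw [smul_zero, hf0, inner_zero_right] at h1
    rw [h1]
    refine integral_congr_ae ?_
    filter_upwards [hS] with ξ hξ
    rw [pker_zero hξ, mul_one]
  have hre := ae_re_map_ne_zero hS hψrot T
  have hF0 : ∀ n, 0 ≤ᵐ[ψ] F n := fun n => by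
    filter_upwards [hS, hre, hbound c n] with ξ h1 h2 h3
    exact (pker_sub_equator_spec hz1 hz0 hT h1 h2).2.2 _ (h3.trans_eq hc1)
  have hFint : ∀ n, ∫ ξ, F n ξ ∂ψ = inner ℝ c (f z) - inner ℝ c (f (r n • z)) := by
    intro n
    rw [hFe, integral_sub hsD.1 (hgD n).1, hsD.2, (hgD n).2, hg0, integral_bdrySign_map hψrot,
      ← Upois_map hψrot, hT, ← heq, ← (hpois c n).2 z hz1, hcz]
    ring
  obtain ⟨ns, hns, hconv⟩ := exists_seq_tendsto_zero_ae_of_tendsto_integral hFi hF0 (by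
    simp only [hFint]
    simpa using (hdil c z hz1).const_sub (inner ℝ c (f z)))
  have hbdry : ∀ᵐ ξ ∂ψ, Tendsto (fun i => f (r (ns i) • ξ)) atTop (𝓝 (bdrySign (T ξ) • c)) := by
    filter_upwards [hS, hre, hconv] with ξ h1 h2 h3
    obtain ⟨hsq, hD0, -⟩ := pker_sub_equator_spec hz1 hz0 hT h1 h2
    have h4 : Tendsto (fun i => 2 * bdrySign (T ξ) * (F (ns i) ξ / D ξ)) atTop (𝓝 0) := by
      simpa using (h3.div_const (D ξ)).const_mul (2 * bdrySign (T ξ))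
    have h5 : Tendsto (fun i => ‖f (r (ns i) • ξ) - bdrySign (T ξ) • c‖ ^ 2) atTop (𝓝 0) := by
      refine squeeze_zero (fun i => by positivity) (fun i => ?_) h4
      have h6 : F (ns i) ξ / D ξ = bdrySign (T ξ) - inner ℝ c (f (r (ns i) • ξ)) :=
        mul_div_cancel_right₀ _ hD0
      have h7 := hbd _ (hmem (ns i) ξ h1.le)
      rw [h6, norm_sub_sq_real, inner_smul_right, norm_smul, hc1, mul_one, Real.norm_eq_abs, sq_abs,
        hsq, real_inner_comm]
      nlinarith [norm_nonneg (f (r (ns i) • ξ))]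
    rw [tendsto_iff_norm_sub_tendsto_zero]
    simpa using h5.sqrt
  refine ⟨c, T, hc1, fun x hx => ?_⟩
  have hx1 : ‖x‖ < 1 := mem_ball_zero_iff.1 hx
  refine ext_inner_left ℝ fun a => ?_
  have hlim : Tendsto (fun i => ∫ ξ, inner ℝ a (f (r (ns i) • ξ)) * pker x ξ ∂ψ) atTop
      (𝓝 (∫ ξ, inner ℝ a (bdrySign (T ξ) • c) * pker x ξ ∂ψ)) := by
    refine tendsto_integral_filter_of_dominated_convergence
      (fun _ => ‖a‖ * (1 / (1 - ‖x‖) ^ 4)) ?_ ?_ (integrable_const _) ?_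
    · exact Eventually.of_forall fun i =>
        (hpois a (ns i)).1.mul (measurable_pker x).aestronglyMeasurable
    · refine Eventually.of_forall fun i => ?_
      filter_upwards [hS, hbound a (ns i)] with ξ h1 h2
      rw [Real.norm_eq_abs, abs_mul]
      exact mul_le_mul h2 (abs_pker_le hx1 le_rfl h1) (abs_nonneg _) (norm_nonneg _)
    · filter_upwards [hbdry] with ξ h1
      exact (tendsto_const_nhds.inner h1).mul_const _
  have hlim' := (hdil a x hx1).comp hns.tendsto_atTop
  have hval : ∫ ξ, inner ℝ a (bdrySign (T ξ) • c) * pker x ξ ∂ψ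
      = inner ℝ a (c * ((Upois ψ (T x) : ℝ) : ℍ[ℝ])) := by
    rw [← Quaternion.coe_commutes, Quaternion.coe_mul_eq_smul, inner_smul_right, Upois_map hψrot,
      ← integral_mul_const]
    refine integral_congr_ae (ae_of_all _ fun ξ => ?_)
    simp only [inner_smul_right]
    ring
  rw [← hval]
  refine tendsto_nhds_unique hlim' (hlim.congr fun i => ?_)
  exact ((hpois a (ns i)).2 x hx1).symm
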